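/- Let n be a positive integer, s > 0, ρ ∈ (-1, 1), and let p be the variance-gamma density with parameters ν = (n-1)/2, α = n/(s(1-ρ²)), β = nρ/(s(1-ρ²)), μ = 0. For every positive integer k, set ℓ = ⌈k/2⌉ + 1/2 and m = k mod 2. Then ∫_ℝ x^k p(x) dx = ((2s/n)^k (2ρ)^m (1-ρ²)^{n/2+k} / (√π Γ(n/2))) · Γ((n-1)/2 + ℓ) Γ(ℓ) · ₂F₁(ℓ, (n-1)/2 + ℓ; 1/2 + m; ρ²). -/

import Mathlib

open MeasureTheory Real Filter

/-- The modified Bessel function of the second kind `K_ν(x)`. -/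
noncomputable def besselK (ν x : ℝ) : ℝ :=
  ∫ t in Set.Ioi (0 : ℝ), Real.exp (-x * Real.cosh t) * Real.cosh (ν * t)

/-- The variance-gamma density with parameters `(ν, α, β, 0)`. -/
noncomputable def vgDensity (ν α β x : ℝ) : ℝ :=
  (α ^ 2 - β ^ 2) ^ (ν + 1/2) / (Real.sqrt π * (2 * α) ^ ν * Real.Gamma (ν + 1/2)) *
    (Real.exp (β * x) * |x| ^ ν * besselK ν (α * |x|))

/-- The ascending factorial `(u)_j = u (u+1) ⋯ (u+j-1)`. -/
noncomputable def ascFactorial (u : ℝ) (j : ℕ) : ℝ := ∏ i ∈ Finset.range j, (u + i)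

/-- The Gaussian hypergeometric function `₂F₁(a, b; c; x)`. -/
noncomputable def hyp2F1 (a b c x : ℝ) : ℝ :=
  ∑' j : ℕ, ascFactorial a j * ascFactorial b j / ascFactorial c j * x ^ j / (Nat.factorial j)

lemma w_integrable (ν y : ℝ) (hν : 0 ≤ ν) (hy : 0 < y) :
    IntegrableOn (fun w : ℝ => w ^ (ν - 1) * Real.exp (-w - y ^ 2 / (4 * w))) (Set.Ioi 0) := by
  have h := (Real.GammaIntegral_convergent (s := ν + 1) (by linarith)).const_mul (4 / y ^ 2)
  refine Integrable.mono' h ?_ ?_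
  · exact Measurable.aestronglyMeasurable (by fun_prop)
  · refine (ae_restrict_iff' measurableSet_Ioi).2 (Eventually.of_forall fun w hw => ?_)
    have hw : 0 < w := hw
    rw [Real.norm_of_nonneg (by positivity), sub_eq_add_neg (-w), Real.exp_add]
    have h1 : Real.exp (-(y ^ 2 / (4 * w))) ≤ 4 * w / y ^ 2 := by
      rw [Real.exp_neg]
      have : y ^ 2 / (4 * w) ≤ Real.exp (y ^ 2 / (4 * w)) := by
        have := Real.add_one_le_exp (y ^ 2 / (4 * w)); linarith
      calc (Real.exp (y ^ 2 / (4 * w)))⁻¹ ≤ (y ^ 2 / (4 * w))⁻¹ := by gcongr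
        _ = _ := by rw [inv_div]
    calc w ^ (ν - 1) * (Real.exp (-w) * Real.exp (-(y ^ 2 / (4 * w))))
        ≤ w ^ (ν - 1) * (Real.exp (-w) * (4 * w / y ^ 2)) := by gcongr
      _ = 4 / y ^ 2 * (Real.exp (-w) * w ^ (ν + 1 - 1)) := by
        rw [add_sub_cancel_right, Real.rpow_sub_one hw.ne']; field_simp

lemma exp_image (y : ℝ) (hy : 0 < y) :
    (fun t : ℝ => y / 2 * Real.exp t) '' Set.univ = Set.Ioi 0 := by
  ext w
  simp only [Set.image_univ, Set.mem_range, Set.mem_Ioi]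
  constructor
  · rintro ⟨t, rfl⟩; positivity
  · intro hw
    exact ⟨Real.log (w * 2 / y), by rw [Real.exp_log (by positivity)]; field_simp⟩

lemma pt_eq (ν y t : ℝ) (hy : 0 < y) :
    |y / 2 * Real.exp t| • ((y / 2 * Real.exp t) ^ (ν - 1) *
      Real.exp (-(y / 2 * Real.exp t) - y ^ 2 / (4 * (y / 2 * Real.exp t)))) =
    (y / 2) ^ ν * (Real.exp (ν * t) * Real.exp (-y * Real.cosh t)) := by
  have h0 : 0 < y / 2 * Real.exp t := by positivity
  rw [abs_of_pos h0, smul_eq_mul, ← mul_assoc, mul_comm (y / 2 * Real.exp t),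
    ← Real.rpow_add_one h0.ne', sub_add_cancel, Real.mul_rpow (by positivity) (by positivity),
    ← Real.exp_mul, mul_comm t ν, mul_assoc]
  congr 3
  rw [Real.cosh_eq, Real.exp_neg]
  field_simp
  ring

lemma bessel_rep (ν y : ℝ) (hν : 0 ≤ ν) (hy : 0 < y) :
    y ^ ν * besselK ν y =
      2 ^ (ν - 1) * ∫ w in Set.Ioi (0 : ℝ), w ^ (ν - 1) * Real.exp (-w - y ^ 2 / (4 * w)) := by
  have hd : ∀ t ∈ (Set.univ : Set ℝ),
      HasDerivWithinAt (fun t : ℝ => y / 2 * Real.exp t) (y / 2 * Real.exp t) Set.univ t :=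
    fun t _ => ((Real.hasDerivAt_exp t).const_mul (y / 2)).hasDerivWithinAt
  have hinj : Set.InjOn (fun t : ℝ => y / 2 * Real.exp t) Set.univ := by
    intro a _ b _ hab
    have : y / 2 ≠ 0 := by positivity
    simpa [hy.ne'] using hab
  set f : ℝ → ℝ := fun t => Real.exp (ν * t) * Real.exp (-y * Real.cosh t) with hf
  have hint := w_integrable ν y hν hy
  rw [← exp_image y hy, integrableOn_image_iff_integrableOn_abs_deriv_smul MeasurableSet.univ hd hinj] at hint
  have hfi : Integrable f := by
    rw [integrableOn_univ] at hint
    have h2 : Integrable (fun t => (y / 2) ^ ν * f t) := by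
      refine hint.congr (Eventually.of_forall fun t => ?_)
      exact pt_eq ν y t hy
    have h3 := h2.const_mul ((y / 2) ^ ν)⁻¹
    refine h3.congr (Eventually.of_forall fun t => ?_)
    have : (y / 2) ^ ν ≠ 0 := by positivity
    simp only
    field_simp
  rw [← exp_image y hy, integral_image_eq_integral_abs_deriv_smul MeasurableSet.univ hd hinj]
  simp_rw [pt_eq ν y _ hy]
  rw [setIntegral_univ, integral_const_mul]
  have h1 : ∫ t, f t = 2 * besselK ν y := by
    have ha : ∫ t, f t + f (-t) = 2 * ∫ t, f t := by
      rw [integral_add hfi hfi.comp_neg, integral_neg_eq_self f]; ring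
    have hb : ∫ t, f t + f (-t) = 2 * (2 * besselK ν y) := by
      rw [besselK, ← integral_comp_abs (f := fun t => Real.exp (-y * Real.cosh t) * Real.cosh (ν * t)), ← integral_const_mul]
      refine integral_congr_ae (Eventually.of_forall fun t => ?_)
      simp only [hf, Real.cosh_abs, Real.cosh_neg]
      have : Real.cosh (ν * |t|) = Real.cosh (ν * t) := by
        rcases abs_choice t with h | h <;> rw [h]
        rw [mul_neg, Real.cosh_neg]
      rw [this, Real.cosh_eq (ν * t), mul_neg]
      ring
    linarith
  change _ = 2 ^ (ν - 1) * ((y / 2) ^ ν * ∫ t, f t)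
  rw [h1, Real.div_rpow hy.le (by norm_num), Real.rpow_sub_one (by norm_num)]
  have : (2 : ℝ) ^ ν ≠ 0 := by positivity
  field_simp

lemma gauss_mom (q : ℕ) (b : ℝ) (hb : 0 < b) :
    ∫ x in Set.Ioi (0 : ℝ), x ^ (2 * q) * Real.exp (-b * x ^ 2) =
      b ^ (-((q : ℝ) + 1 / 2)) * (1 / 2) * Real.Gamma (q + 1 / 2) := by
  have h := integral_rpow_mul_exp_neg_mul_rpow (p := 2) (q := ((2 * q : ℕ) : ℝ)) (b := b)
    (by norm_num) (by have : (0 : ℝ) ≤ ((2 * q : ℕ) : ℝ) := by positivity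
                      linarith) hb
  simp only [Real.rpow_natCast, Real.rpow_two] at h
  rw [h]
  push_cast
  congr 3 <;> ring

lemma mellin_one (ν : ℝ) (hν : 0 ≤ ν) (q : ℕ) :
    ∫ y in Set.Ioi (0 : ℝ), y ^ (2 * q) * (y ^ ν * besselK ν y) =
      2 ^ (2 * (q : ℝ) + ν - 1) * Real.Gamma (ν + q + 1 / 2) * Real.Gamma (q + 1 / 2) := by
  set μ := (volume : Measure ℝ).restrict (Set.Ioi 0) with hμ
  set h : ℝ × ℝ → ℝ := fun z => z.1 ^ (2 * q) * (z.2 ^ (ν - 1) * Real.exp (-z.2 - z.1 ^ 2 / (4 * z.2))) with hh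
  have hpt : ∀ x w : ℝ, 0 < w → h (x, w) = (w ^ (ν - 1) * Real.exp (-w)) * (x ^ (2 * q) * Real.exp (-(4 * w)⁻¹ * x ^ 2)) := by
    intro x w hw
    simp only [hh]
    rw [show -w - x ^ 2 / (4 * w) = -w + -(4 * w)⁻¹ * x ^ 2 by field_simp; ring, Real.exp_add]
    ring
  have hin : ∀ w : ℝ, 0 < w → ∫ x, h (x, w) ∂μ =
      (4 ^ ((q : ℝ) + 1 / 2) * (1 / 2) * Real.Gamma (q + 1 / 2)) * (Real.exp (-w) * w ^ (ν + q + 1 / 2 - 1)) := by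
    intro w hw
    simp_rw [hpt _ w hw]
    rw [integral_const_mul, hμ, gauss_mom q _ (by positivity), Real.rpow_neg (by positivity),
      Real.inv_rpow (by positivity), inv_inv, Real.mul_rpow (by norm_num) hw.le,
      show ν + q + 1 / 2 - 1 = (ν - 1) + (q + 1 / 2) by ring, Real.rpow_add hw (ν - 1)]
    ring
  have hGq : 0 < Real.Gamma ((q : ℝ) + 1 / 2) := Real.Gamma_pos_of_pos (by positivity)
  have hmem : ∀ᵐ w ∂μ, 0 < w := ae_restrict_mem measurableSet_Ioi
  have hint : Integrable h (μ.prod μ) := by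
    rw [integrable_prod_iff' (Measurable.aestronglyMeasurable (by fun_prop))]
    constructor
    · filter_upwards [hmem] with w hw
      apply Integrable.of_integral_ne_zero
      rw [hin w hw]
      positivity
    · have hg := ((Real.GammaIntegral_convergent (s := ν + q + 1 / 2) (by positivity)).const_mul
        (4 ^ ((q : ℝ) + 1 / 2) * (1 / 2) * Real.Gamma (q + 1 / 2)))
      refine Integrable.congr hg ?_
      filter_upwards [hmem] with w hw
      rw [← hin w hw]
      refine integral_congr_ae (Eventually.of_forall fun x => ?_)
      simp only [hh]
      rw [Real.norm_of_nonneg]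
      rw [pow_mul]
      positivity
  have e1 : ∫ y in Set.Ioi (0 : ℝ), y ^ (2 * q) * (y ^ ν * besselK ν y) =
      2 ^ (ν - 1) * ∫ y, (∫ w, h (y, w) ∂μ) ∂μ := by
    rw [← integral_const_mul]
    refine integral_congr_ae ?_
    filter_upwards [hmem] with y hy
    rw [bessel_rep ν y hν hy]
    simp only [hh]
    rw [integral_const_mul]
    ring
  rw [e1, integral_integral_swap (f := fun y w => h (y, w)) hint]
  have e2 : ∫ w, ∫ x, h (x, w) ∂μ ∂μ = ∫ w, (4 ^ ((q : ℝ) + 1 / 2) * (1 / 2) * Real.Gamma (q + 1 / 2)) * (Real.exp (-w) * w ^ (ν + q + 1 / 2 - 1)) ∂μ := by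
    refine integral_congr_ae ?_
    filter_upwards [hmem] with w hw
    exact hin w hw
  rw [e2, integral_const_mul, hμ, ← Real.Gamma_eq_integral (by positivity),
    show (4 : ℝ) = 2 ^ (2 : ℝ) by norm_num, ← Real.rpow_mul (by norm_num),
    show 2 * (q : ℝ) + ν - 1 = (ν - 1) + (2 * (q + 1 / 2)) - 1 by ring,
    Real.rpow_sub_one (by norm_num) (ν - 1 + 2 * (q + 1 / 2)), Real.rpow_add (by norm_num) (ν - 1)]
  ring

lemma mellin_real (ν α : ℝ) (hν : 0 ≤ ν) (hα : 0 < α) (q : ℕ) :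
    ∫ x : ℝ, x ^ (2 * q) * (|x| ^ ν * besselK ν (α * |x|)) =
      2 ^ (2 * (q : ℝ) + ν) * α ^ (-(2 * (q : ℝ) + ν + 1)) *
        Real.Gamma (ν + q + 1 / 2) * Real.Gamma (q + 1 / 2) := by
  have h1 : ∀ x : ℝ, x ^ (2 * q) * (|x| ^ ν * besselK ν (α * |x|)) =
      (fun y => α ^ (-(2 * (q : ℝ) + ν)) * ((α * y) ^ (2 * q) * ((α * y) ^ ν * besselK ν (α * y)))) |x| := by
    intro x
    simp only
    rw [Real.mul_rpow hα.le (abs_nonneg x), mul_pow, Real.rpow_neg hα.le, Real.rpow_add hα, pow_mul |x|, sq_abs, ← pow_mul,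
      show (2 * (q : ℝ)) = ((2 * q : ℕ) : ℝ) by push_cast; ring, Real.rpow_natCast]
    have : α ^ ν ≠ 0 := by positivity
    field_simp
  rw [integral_congr_ae (Eventually.of_forall h1)]
  rw [integral_comp_abs (f := fun y => α ^ (-(2 * (q : ℝ) + ν)) *
      ((α * y) ^ (2 * q) * ((α * y) ^ ν * besselK ν (α * y)))), integral_const_mul,
    integral_comp_mul_left_Ioi (fun y => y ^ (2 * q) * (y ^ ν * besselK ν y)) 0 hα, mul_zero,
    mellin_one ν hν q, neg_add _ (1 : ℝ), Real.rpow_add hα, Real.rpow_neg_one, Real.rpow_sub_one (by norm_num), smul_eq_mul]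
  ring

lemma asc_succ (u : ℝ) (j : ℕ) : ascFactorial u (j + 1) = ascFactorial u j * (u + j) := by
  simp [ascFactorial, Finset.prod_range_succ]

lemma asc_pos (u : ℝ) (hu : 0 < u) (j : ℕ) : 0 < ascFactorial u j :=
  Finset.prod_pos fun i _ => by positivity

lemma Gamma_asc (u : ℝ) (hu : 0 < u) (j : ℕ) :
    Real.Gamma (u + j) = Real.Gamma u * ascFactorial u j := by
  induction j with
  | zero => simp [ascFactorial]
  | succ j ih =>
    rw [asc_succ, Nat.cast_succ, ← add_assoc, Real.Gamma_add_one (by positivity), ih]; ring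

lemma fact_asc (m : ℕ) (hm : m < 2) (j : ℕ) :
    ((2 * j + m).factorial : ℝ) = 4 ^ j * j.factorial * ascFactorial (1 / 2 + (m : ℕ)) j := by
  induction j with
  | zero => interval_cases m <;> simp [ascFactorial]
  | succ j ih =>
    rw [asc_succ, show 2 * (j + 1) + m = (2 * j + m) + 1 + 1 by ring, Nat.factorial_succ,
      Nat.factorial_succ, Nat.factorial_succ j]
    push_cast
    rw [ih, pow_succ]
    interval_cases m <;> push_cast <;> ring

lemma hyp_summable (a b c x : ℝ) (ha : 0 < a) (hb : 0 < b) (hc : 0 < c) (hx : |x| < 1) :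
    Summable fun j : ℕ => ascFactorial a j * ascFactorial b j / ascFactorial c j * x ^ j /
      (Nat.factorial j) := by
  obtain ⟨r, hr1, hr2⟩ := exists_between hx
  have key : ∀ u v : ℝ, Tendsto (fun j : ℕ => (u + j) / (v + j)) atTop (nhds 1) := by
    intro u v
    have h1 : Tendsto (fun j : ℕ => (u / j + 1) / (v / j + 1)) atTop (nhds ((0 + 1) / (0 + 1))) :=
      (((tendsto_const_div_atTop_nhds_zero_nat u).add_const 1).div
        ((tendsto_const_div_atTop_nhds_zero_nat v).add_const 1) (by norm_num))
    norm_num at h1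
    refine h1.congr' ?_
    filter_upwards [eventually_gt_atTop 0] with j hj
    have : (j : ℝ) ≠ 0 := by positivity
    rw [← mul_div_mul_right _ _ this]
    congr 1 <;> field_simp
  have hlim : Tendsto (fun j : ℕ => (a + j) / (c + j) * ((b + j) / (1 + j)) * |x|) atTop (nhds |x|) := by
    simpa using ((key a c).mul (key b 1)).mul_const |x|
  refine summable_of_ratio_norm_eventually_le hr2 ?_
  filter_upwards [hlim.eventually (gt_mem_nhds hr1)] with j hj
  have h1 := asc_pos a ha j
  have h2 := asc_pos b hb j
  have h3 := asc_pos c hc j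
  have : ascFactorial a (j + 1) * ascFactorial b (j + 1) / ascFactorial c (j + 1) * x ^ (j + 1) / (Nat.factorial (j + 1)) =
      ((a + j) / (c + j) * ((b + j) / (1 + j)) * x) * (ascFactorial a j * ascFactorial b j / ascFactorial c j * x ^ j / (Nat.factorial j)) := by
    rw [asc_succ, asc_succ, asc_succ, Nat.factorial_succ]
    push_cast
    have : c + j ≠ 0 := by positivity
    have : (1 : ℝ) + j ≠ 0 := by positivity
    have : (j : ℝ) + 1 ≠ 0 := by positivity
    field_simp
    ring
  rw [this, norm_mul]
  gcongr
  rw [norm_mul, Real.norm_of_nonneg (by positivity), Real.norm_eq_abs]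
  exact hj.le

/-- The even moment. -/
noncomputable def momT (ν α : ℝ) (q : ℕ) : ℝ :=
  2 ^ (2 * (q : ℝ) + ν) * α ^ (-(2 * (q : ℝ) + ν + 1)) *
        Real.Gamma (ν + q + 1 / 2) * Real.Gamma (q + 1 / 2)

lemma momT_pos (ν α : ℝ) (hν : 0 ≤ ν) (hα : 0 < α) (q : ℕ) : 0 < momT ν α q := by
  have h1 : 0 < Real.Gamma (ν + q + 1 / 2) := Real.Gamma_pos_of_pos (by positivity)
  have h2 : 0 < Real.Gamma ((q : ℝ) + 1 / 2) := Real.Gamma_pos_of_pos (by positivity)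
  unfold momT
  positivity

lemma term_eq (ν α ρ : ℝ) (hν : 0 ≤ ν) (hα : 0 < α) (L m : ℕ) (hm : m < 2) (j : ℕ) :
    (α * ρ) ^ (2 * j + m) / ((2 * j + m).factorial : ℝ) * momT ν α (L + j) =
      ((α * ρ) ^ m * momT ν α L) *
      (ascFactorial ((L : ℝ) + 1 / 2) j * ascFactorial (ν + ((L : ℝ) + 1 / 2)) j /
        ascFactorial (1 / 2 + (m : ℕ)) j * (ρ ^ 2) ^ j / (Nat.factorial j)) := by
  have hc := asc_pos (1 / 2 + (m : ℕ)) (by positivity) j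
  rw [fact_asc m hm, momT, momT]
  push_cast
  rw [show ν + ((L : ℝ) + j) + 1 / 2 = (ν + (L + 1 / 2)) + j by ring,
    show (L : ℝ) + j + 1 / 2 = (L + 1 / 2) + j by ring,
    Gamma_asc _ (by positivity), Gamma_asc _ (by positivity),
    show ν + (L : ℝ) + 1 / 2 = ν + (L + 1 / 2) by ring,
    show 2 * ((L : ℝ) + j) + ν = (2 * L + ν) + (2 * j : ℕ) by push_cast; ring,
    show -(2 * (L : ℝ) + ν + (2 * j : ℕ) + 1) = -(2 * L + ν + 1) - (2 * j : ℕ) by push_cast; ring,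
    Real.rpow_add_natCast (by norm_num), Real.rpow_sub_natCast hα.ne', pow_add, pow_mul 2 2 j, mul_pow α ρ (2 * j),
    ← pow_mul]
  have h4 : ((2 : ℝ) ^ 2) ^ j = 4 ^ j := by norm_num
  rw [pow_mul 2 2 j, h4, pow_mul ρ 2 j]
  field_simp


lemma besselK_nonneg (ν x : ℝ) : 0 ≤ besselK ν x :=
  integral_nonneg fun _ => mul_nonneg (Real.exp_pos _).le (Real.cosh_pos _).le

/-- The even kernel. -/
noncomputable def kerH (ν α x : ℝ) : ℝ := |x| ^ ν * besselK ν (α * |x|)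

lemma kerH_nonneg (ν α x : ℝ) : 0 ≤ kerH ν α x :=
  mul_nonneg (by positivity) (besselK_nonneg _ _)

lemma kerH_mom (ν α : ℝ) (hν : 0 ≤ ν) (hα : 0 < α) (q : ℕ) :
    ∫ x : ℝ, x ^ (2 * q) * kerH ν α x = momT ν α q := mellin_real ν α hν hα q

lemma kerH_int (ν α : ℝ) (hν : 0 ≤ ν) (hα : 0 < α) (q : ℕ) :
    Integrable fun x : ℝ => x ^ (2 * q) * kerH ν α x :=
  .of_integral_ne_zero (by rw [kerH_mom ν α hν hα]; exact (momT_pos ν α hν hα q).ne')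

lemma series_int (ν α ρ : ℝ) (hν : 0 ≤ ν) (hα : 0 < α) (hρ : |ρ| < 1) (k L m : ℕ) (hm : m < 2)
    (hk : k + m = 2 * L) :
    ∫ x : ℝ, x ^ k * (∑' j : ℕ, (α * ρ * x) ^ (2 * j + m) / ((2 * j + m).factorial : ℝ)) *
        kerH ν α x =
      ((α * ρ) ^ m * momT ν α L) *
        hyp2F1 ((L : ℝ) + 1 / 2) (ν + ((L : ℝ) + 1 / 2)) (1 / 2 + (m : ℕ)) (ρ ^ 2) := by
  set F : ℕ → ℝ → ℝ := fun j x => (α * ρ) ^ (2 * j + m) / ((2 * j + m).factorial : ℝ) *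
    (x ^ (2 * (L + j)) * kerH ν α x) with hF
  have hFi : ∀ j, Integrable (F j) := fun j => (kerH_int ν α hν hα (L + j)).const_mul _
  have hFv : ∀ j, ∫ x, F j x = (α * ρ) ^ (2 * j + m) / ((2 * j + m).factorial : ℝ) * momT ν α (L + j) := by
    intro j
    simp only [hF]
    rw [integral_const_mul, kerH_mom ν α hν hα]
  have hFn : ∀ j, ∫ x, ‖F j x‖ = (α * |ρ|) ^ (2 * j + m) / ((2 * j + m).factorial : ℝ) * momT ν α (L + j) := by
    intro j
    rw [← kerH_mom ν α hν hα, ← integral_const_mul]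
    refine integral_congr_ae (Eventually.of_forall fun x => ?_)
    have h0 : 0 ≤ x ^ (2 * (L + j)) * kerH ν α x :=
      mul_nonneg (by rw [pow_mul]; positivity) (kerH_nonneg _ _ _)
    simp only [hF]
    rw [norm_mul, Real.norm_of_nonneg h0, norm_div, norm_pow, norm_mul, Real.norm_of_nonneg hα.le,
      Real.norm_eq_abs, Real.norm_of_nonneg (Nat.cast_nonneg _)]
  have hsq : |ρ ^ 2| < 1 := by
    rw [abs_pow]; exact pow_lt_one₀ (abs_nonneg _) hρ (by norm_num)
  have hsum : Summable fun j => ∫ x, ‖F j x‖ := by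
    simp_rw [hFn, term_eq ν α |ρ| hν hα L m hm, sq_abs]
    exact (hyp_summable _ _ _ _ (by positivity) (by positivity) (by positivity) hsq).mul_left _
  have hs := hasSum_integral_of_summable_integral_norm hFi hsum
  have e1 : ∀ x : ℝ, x ^ k * (∑' j : ℕ, (α * ρ * x) ^ (2 * j + m) / ((2 * j + m).factorial : ℝ)) *
        kerH ν α x = ∑' j, F j x := by
    intro x
    rw [← tsum_mul_left, ← tsum_mul_right]
    refine tsum_congr fun j => ?_
    simp only [hF]
    rw [show 2 * (L + j) = k + (2 * j + m) by omega, mul_pow (α * ρ) x, pow_add x k]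
    ring
  simp_rw [e1]
  rw [← hs.tsum_eq]
  simp_rw [hFv, term_eq ν α ρ hν hα L m hm]
  rw [tsum_mul_left, hyp2F1]

lemma cosh_int (ν α ρ : ℝ) (hν : 0 ≤ ν) (hα : 0 < α) (hρ : |ρ| < 1) (L : ℕ) :
    Integrable fun x : ℝ => x ^ (2 * L) * Real.cosh (α * ρ * x) * kerH ν α x := by
  apply Integrable.of_integral_ne_zero
  have h := series_int ν α ρ hν hα hρ (2 * L) L 0 (by norm_num) rfl
  simp only [add_zero, ← Real.cosh_eq_tsum] at h
  rw [h]
  have hsq : |ρ ^ 2| < 1 := by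
    rw [abs_pow]; exact pow_lt_one₀ (abs_nonneg _) hρ (by norm_num)
  have hp : 0 < hyp2F1 ((L : ℝ) + 1 / 2) (ν + ((L : ℝ) + 1 / 2)) (1 / 2 + (0 : ℕ)) (ρ ^ 2) := by
    refine (hyp_summable _ _ _ _ (by positivity) (by positivity) (by positivity) hsq).tsum_pos
      (fun j => ?_) 0 (by simp [ascFactorial])
    have h1 := asc_pos ((L : ℝ) + 1 / 2) (by positivity) j
    have h2 := asc_pos (ν + ((L : ℝ) + 1 / 2)) (by positivity) j
    have h3 := asc_pos (1 / 2 + (0 : ℕ)) (by positivity) j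
    positivity
  have := momT_pos ν α hν hα L
  simp only [pow_zero, one_mul]
  exact (mul_pos this hp).ne'

lemma exp_int (ν α ρ : ℝ) (hν : 0 ≤ ν) (hα : 0 < α) (hρ : |ρ| < 1) (k : ℕ) :
    Integrable fun x : ℝ => x ^ k * Real.exp (α * ρ * x) * kerH ν α x := by
  have hd := ((cosh_int ν α ρ hν hα hρ 0).add (cosh_int ν α ρ hν hα hρ k)).const_mul 2
  refine hd.mono' ?_ (Eventually.of_forall fun x => ?_)
  · have h0 := (kerH_int ν α hν hα 0).aestronglyMeasurable
    simp only [mul_zero, pow_zero, one_mul] at h0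
    exact AEStronglyMeasurable.mul (Measurable.aestronglyMeasurable (by fun_prop)) h0
  · have hH := kerH_nonneg ν α x
    rw [norm_mul, norm_mul, norm_pow, Real.norm_of_nonneg hH, Real.norm_of_nonneg (Real.exp_pos _).le,
      Real.norm_eq_abs]
    simp only [Pi.add_apply, mul_zero, pow_zero, one_mul]
    have h1 : |x| ^ k ≤ 1 + x ^ (2 * k) := by
      have : x ^ (2 * k) = (|x| ^ k) ^ 2 := by rw [pow_mul, ← sq_abs, ← pow_mul, ← pow_mul, mul_comm]
      rw [this]; nlinarith [sq_nonneg (|x| ^ k - 1)]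
    have h2 : Real.exp (α * ρ * x) ≤ 2 * Real.cosh (α * ρ * x) := by
      rw [Real.cosh_eq]; have := Real.exp_pos (-(α * ρ * x)); linarith
    calc |x| ^ k * Real.exp (α * ρ * x) * kerH ν α x
        ≤ (1 + x ^ (2 * k)) * (2 * Real.cosh (α * ρ * x)) * kerH ν α x := by
          have : 0 ≤ 1 + x ^ (2 * k) := le_trans (by positivity) h1
          gcongr
      _ = _ := by ring

lemma full_int (ν α ρ : ℝ) (hν : 0 ≤ ν) (hα : 0 < α) (hρ : |ρ| < 1) (k L m : ℕ) (hm : m < 2)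
    (hk : k + m = 2 * L) :
    ∫ x : ℝ, x ^ k * Real.exp (α * ρ * x) * kerH ν α x =
      ((α * ρ) ^ m * momT ν α L) *
        hyp2F1 ((L : ℝ) + 1 / 2) (ν + ((L : ℝ) + 1 / 2)) (1 / 2 + (m : ℕ)) (ρ ^ 2) := by
  rw [← series_int ν α ρ hν hα hρ k L m hm hk]
  set f : ℝ → ℝ := fun x => x ^ k * Real.exp (α * ρ * x) * kerH ν α x with hf
  have hfi : Integrable f := exp_int ν α ρ hν hα hρ k
  have ha : ∫ t, f t + f (-t) = 2 * ∫ t, f t := by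
    rw [integral_add hfi hfi.comp_neg, integral_neg_eq_self f]; ring
  have hb : ∫ t, f t + f (-t) = 2 * ∫ x : ℝ, x ^ k *
      (∑' j : ℕ, (α * ρ * x) ^ (2 * j + m) / ((2 * j + m).factorial : ℝ)) * kerH ν α x := by
    rw [← integral_const_mul]
    refine integral_congr_ae (Eventually.of_forall fun x => ?_)
    simp only [hf]
    have hneg : kerH ν α (-x) = kerH ν α x := by simp [kerH]
    rw [hneg, mul_neg]
    interval_cases m
    · simp only [add_zero, ← Real.cosh_eq_tsum]
      rw [Even.neg_pow ⟨L, by omega⟩, Real.cosh_eq]; ring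
    · simp only [← Real.sinh_eq_tsum]
      rw [Odd.neg_pow ⟨L - 1, by omega⟩, Real.sinh_eq]; ring
  linarith

theorem normal_product_mean_moment (n : ℕ) (hn : 0 < n) (s ρ : ℝ) (hs : 0 < s)
    (hρ : ρ ∈ Set.Ioo (-1 : ℝ) 1) (k : ℕ) (hk : 0 < k) :
    ∫ x : ℝ, x ^ k *
        vgDensity (((n : ℝ) - 1)/2) ((n : ℝ)/(s * (1 - ρ ^ 2))) ((n : ℝ) * ρ/(s * (1 - ρ ^ 2))) x =
      (2 * s / (n : ℝ)) ^ k * (2 * ρ) ^ (k % 2) * (1 - ρ ^ 2) ^ ((n : ℝ)/2 + (k : ℝ)) /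
          (Real.sqrt π * Real.Gamma ((n : ℝ)/2)) *
        Real.Gamma (((n : ℝ) - 1)/2 + ((⌈(k : ℝ)/2⌉₊ : ℝ) + 1/2)) *
        Real.Gamma ((⌈(k : ℝ)/2⌉₊ : ℝ) + 1/2) *
        hyp2F1 ((⌈(k : ℝ)/2⌉₊ : ℝ) + 1/2) (((n : ℝ) - 1)/2 + ((⌈(k : ℝ)/2⌉₊ : ℝ) + 1/2))
          (1/2 + (k % 2 : ℕ)) (ρ ^ 2) := by
  obtain ⟨hρ1, hρ2⟩ := hρ
  have habs : |ρ| < 1 := abs_lt.2 ⟨hρ1, hρ2⟩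
  have hr : 0 < 1 - ρ ^ 2 := by nlinarith
  have hn' : (0 : ℝ) < n := by exact_mod_cast hn
  have hn1 : (1 : ℝ) ≤ n := by exact_mod_cast hn
  obtain ⟨L, hL⟩ : ∃ L : ℕ, k + k % 2 = 2 * L := ⟨(k + k % 2) / 2, by omega⟩
  have hceil : ⌈(k : ℝ) / 2⌉₊ = L := by
    have hk' : (k : ℝ) + (k % 2 : ℕ) = 2 * L := by exact_mod_cast hL
    have hm' : ((k % 2 : ℕ) : ℝ) ≤ 1 := by exact_mod_cast (by omega : k % 2 ≤ 1)
    have hm0 : (0 : ℝ) ≤ ((k % 2 : ℕ) : ℝ) := by positivity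
    rw [Nat.ceil_eq_iff (by omega)]
    have hL1 : 1 ≤ L := by omega
    constructor
    · push_cast [hL1]; linarith
    · linarith
  rw [hceil]
  set ν : ℝ := ((n : ℝ) - 1) / 2 with hν
  set α : ℝ := (n : ℝ) / (s * (1 - ρ ^ 2)) with hα
  have hν0 : 0 ≤ ν := by rw [hν]; linarith
  have hα0 : 0 < α := by positivity
  have hβ : (n : ℝ) * ρ / (s * (1 - ρ ^ 2)) = α * ρ := by rw [hα]; ring
  rw [hβ]
  have hm : k % 2 < 2 := Nat.mod_lt _ (by norm_num)
  have key := full_int ν α ρ hν0 hα0 habs k L (k % 2) hm hL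
  have e1 : ∀ x : ℝ, x ^ k * vgDensity ν α (α * ρ) x =
      (α ^ 2 - (α * ρ) ^ 2) ^ (ν + 1 / 2) / (Real.sqrt π * (2 * α) ^ ν * Real.Gamma (ν + 1 / 2)) *
      (x ^ k * Real.exp (α * ρ * x) * kerH ν α x) := by
    intro x; rw [vgDensity, kerH]; ring
  simp_rw [e1]
  rw [integral_const_mul, key]
  set Hy := hyp2F1 ((L : ℝ) + 1 / 2) (ν + ((L : ℝ) + 1 / 2)) (1 / 2 + (k % 2 : ℕ)) (ρ ^ 2)
  have hν2 : ν + 1 / 2 = (n : ℝ) / 2 := by rw [hν]; ring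
  have hsα : s / n = (α * (1 - ρ ^ 2))⁻¹ := by rw [hα]; field_simp
  have hG : 0 < Real.Gamma ((n : ℝ) / 2) := Real.Gamma_pos_of_pos (by positivity)
  have hpi : 0 < Real.sqrt π := Real.sqrt_pos.2 Real.pi_pos
  have h2L : (2 * (L : ℝ)) = (k : ℝ) + (k % 2 : ℕ) := by exact_mod_cast hL.symm
  set m := k % 2
  rw [momT, hν2, show α ^ 2 - (α * ρ) ^ 2 = (α * α) * (1 - ρ ^ 2) by ring,
    Real.mul_rpow (by positivity) hr.le, Real.mul_rpow hα0.le hα0.le, ← Real.rpow_add hα0,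
    show (n : ℝ) / 2 + n / 2 = ν + ν + 1 by rw [hν]; ring,
    Real.mul_rpow (by norm_num) hα0.le, mul_div_assoc 2 s, hsα, h2L,
    Real.rpow_add hr, Real.rpow_natCast, neg_add, neg_add, neg_add,
    Real.rpow_add hα0, Real.rpow_add hα0, Real.rpow_add hα0, Real.rpow_add hα0, Real.rpow_add hα0,
    Real.rpow_neg hα0.le, Real.rpow_neg hα0.le, Real.rpow_neg hα0.le, Real.rpow_neg hα0.le,
    Real.rpow_add (by norm_num), Real.rpow_add (by norm_num)]
  simp only [Real.rpow_natCast, Real.rpow_one, mul_pow, inv_pow, add_assoc]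
  have : α ^ ν ≠ 0 := by positivity
  have : (2 : ℝ) ^ ν ≠ 0 := by positivity
  have : (1 - ρ ^ 2) ^ k ≠ 0 := by positivity
  field_simp
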